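/- arXiv:1804.05447 — 8 statements merged into one kernel-verified Lean document; each statement's English description precedes it below -/
import Mathlib

section
/- Let M > 0, δ > 0, γ > 0. Suppose v ∈ ℝⁿ satisfies v = v̂(α*) for some α* ∈ ℝⁿ with ‖α*‖ ≤ M, and let v^δ ∈ ℝⁿ satisfy ‖v^δ − v‖ ≤ δ. If α_γ ∈ ℝⁿ satisfies v̂(α_γ) + γ·α_γ = v^δ, then ‖v̂(α_γ) − v‖ ≤ δ + M·γ. -/
open MeasureTheory RealInnerProductSpace

/-- accuracy of the moment regularization map (Theorem 3 of the
paper), for the Maxwell–Boltzmann moment map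
`v̂(α) = ∫ exp(α ⬝ m v) • m v dμ` on a finite measure space with bounded
measurable basis functions `m`. -/
theorem regularized_moment_accuracy
    {n : ℕ} (hn : 0 < n) {V : Type*} [MeasurableSpace V]
    (μ : Measure V) [IsFiniteMeasure μ]
    (m : V → EuclideanSpace ℝ (Fin n)) (hm : Measurable m)
    (C : ℝ) (hmbd : ∀ v, ‖m v‖ ≤ C)
    (vhat : EuclideanSpace ℝ (Fin n) → EuclideanSpace ℝ (Fin n))
    (hvhat : ∀ α, vhat α = ∫ v, Real.exp ⟪α, m v⟫ • m v ∂μ)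
    (M δ γ : ℝ) (hM : 0 < M) (hδ : 0 < δ) (hγ : 0 < γ)
    (v vδ αstar αγ : EuclideanSpace ℝ (Fin n))
    (hv : v = vhat αstar) (hαstar : ‖αstar‖ ≤ M)
    (hvδ : ‖vδ - v‖ ≤ δ)
    (hαγ : vhat αγ + γ • αγ = vδ) :
    ‖vhat αγ - v‖ ≤ δ + M * γ := by
  have hint : ∀ α : EuclideanSpace ℝ (Fin n),
      Integrable (fun v => Real.exp ⟪α, m v⟫ • m v) μ := by
    intro α
    refine Integrable.of_bound (C := Real.exp (‖α‖ * C) * C) ?_ ?_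
    · apply Measurable.aestronglyMeasurable
      fun_prop
    · refine Filter.Eventually.of_forall fun x => ?_
      rw [norm_smul, Real.norm_eq_abs, Real.abs_exp]
      have h1 : ⟪α, m x⟫ ≤ ‖α‖ * C :=
        (real_inner_le_norm _ _).trans
          (mul_le_mul_of_nonneg_left (hmbd x) (norm_nonneg _))
      exact mul_le_mul (Real.exp_le_exp.mpr h1) (hmbd x) (norm_nonneg _) (Real.exp_pos _).le
  have hmono : 0 ≤ ⟪αγ - αstar, vhat αγ - v⟫ := by
    have hsub : Integrable (fun x => Real.exp ⟪αγ, m x⟫ • m x - Real.exp ⟪αstar, m x⟫ • m x) μ :=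
      (hint αγ).sub (hint αstar)
    rw [hv, hvhat, hvhat, ← integral_sub (hint _) (hint _), ← integral_inner hsub]
    refine integral_nonneg fun x => ?_
    simp only [Pi.zero_apply, inner_sub_left, inner_sub_right, real_inner_smul_right]
    rcases le_total ⟪αγ, m x⟫ ⟪αstar, m x⟫ with h | h
    · have := Real.exp_le_exp.mpr h
      nlinarith
    · have := Real.exp_le_exp.mpr h
      nlinarith
  set w := vhat αγ - v with hw
  have he : w + γ • (αγ - αstar) = (vδ - v) - γ • αstar := by
    rw [hw, ← hαγ, smul_sub]; abel
  have hen : ‖(vδ - v) - γ • αstar‖ ≤ δ + M * γ := by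
    refine (norm_sub_le _ _).trans ?_
    rw [norm_smul, Real.norm_eq_abs, abs_of_pos hγ]
    nlinarith
  have h2 : ‖w‖ * ‖w‖ ≤ ‖w‖ * (δ + M * γ) := by
    have h3 : ⟪w, w + γ • (αγ - αstar)⟫ ≤ ‖w‖ * (δ + M * γ) := by
      rw [he]
      exact (real_inner_le_norm _ _).trans (mul_le_mul_of_nonneg_left hen (norm_nonneg _))
    rw [inner_add_right, real_inner_smul_right, real_inner_self_eq_norm_mul_norm,
      real_inner_comm] at h3
    nlinarith [mul_nonneg hγ.le hmono]
  rcases (norm_nonneg w).eq_or_lt with h | h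
  · rw [← h]; positivity
  · exact le_of_mul_le_mul_left h2 h
end

section
/- Let F : ℝⁿ → ℝⁿ be a monotone map, i.e., ⟨F(x) − F(y), x − y⟩ ≥ 0 for all x, y ∈ ℝⁿ. Let 0 ≤ γ₁ ≤ γ₂ with γ₂ > 0, and suppose α₁, α₂ ∈ ℝⁿ satisfy F(α₁) + γ₁·α₁ = F(α₂) + γ₂·α₂. Then ‖α₂‖ ≤ ‖α₁‖. (In the notation of the paper: the norm ‖α̂_γ(v)‖ of the regularized multiplier vector associated with a fixed moment vector v is a nonincreasing function of the regularization parameter γ.) -/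
open RealInnerProductSpace

/-- for a monotone map `F : ℝⁿ → ℝⁿ`, if `0 ≤ γ₁ ≤ γ₂`, `γ₂ > 0`
and `F(α₁) + γ₁•α₁ = F(α₂) + γ₂•α₂`, then `‖α₂‖ ≤ ‖α₁‖`; i.e. the norm of the
regularized multiplier vector of a fixed moment vector is nonincreasing in the
regularization parameter. -/
theorem regularized_multiplier_norm_nonincreasing
    {n : ℕ} (F : EuclideanSpace ℝ (Fin n) → EuclideanSpace ℝ (Fin n))
    (hF : ∀ x y : EuclideanSpace ℝ (Fin n), 0 ≤ ⟪F x - F y, x - y⟫)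
    (γ₁ γ₂ : ℝ) (hγ₁ : 0 ≤ γ₁) (h12 : γ₁ ≤ γ₂) (hγ₂ : 0 < γ₂)
    (α₁ α₂ : EuclideanSpace ℝ (Fin n))
    (heq : F α₁ + γ₁ • α₁ = F α₂ + γ₂ • α₂) :
    ‖α₂‖ ≤ ‖α₁‖ := by
  have h := hF α₁ α₂
  have hd : F α₁ - F α₂ = γ₂ • α₂ - γ₁ • α₁ := by
    rw [sub_eq_sub_iff_add_eq_add, heq, add_comm]
  rw [hd] at h
  simp only [inner_sub_left, inner_sub_right, real_inner_smul_left,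
    real_inner_self_eq_norm_sq, real_inner_comm α₁ α₂] at h
  have hc : ⟪α₁, α₂⟫ ≤ ‖α₁‖ * ‖α₂‖ := real_inner_le_norm α₁ α₂
  by_contra! hlt
  have h1 : γ₁ * ‖α₁‖ < γ₂ * ‖α₂‖ :=
    lt_of_le_of_lt (mul_le_mul_of_nonneg_right h12 (norm_nonneg _))
      (mul_lt_mul_of_pos_left hlt hγ₂)
  have h2 := mul_pos (sub_pos.2 h1) (sub_pos.2 hlt)
  have h3 := mul_le_mul_of_nonneg_left hc (add_nonneg hγ₁ hγ₂.le)
  nlinarith [h, h2, h3]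
end

section
/- Fix γ > 0 and v ∈ ℝⁿ. For every α ∈ ℝⁿ and every measurable function g : V → [0, ∞) such that η∘g and v' ↦ m(v')·g(v') are μ-integrable, the following weak-duality inequality holds: α · v − ∫_V exp(α · m(v')) dμ(v') − (γ/2)‖α‖² ≤ ∫_V η(g(v')) dμ(v') + (1/(2γ))‖∫_V m(v') g(v') dμ(v') − v‖². -/
open MeasureTheory RealInnerProductSpace

/-- weak duality between the Tikhonov-regularized dual objective
and the relaxed primal entropy functional `H_γ(g; v)`, for the
Maxwell–Boltzmann entropy `η(z) = z log z − z` (`η(0) = 0`; note that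
`Real.log 0 = 0` in Mathlib, so the formula below also covers `z = 0`). -/
theorem regularized_weak_duality
    {n : ℕ} (hn : 0 < n) {V : Type*} [MeasurableSpace V]
    (μ : Measure V) [IsFiniteMeasure μ]
    (m : V → EuclideanSpace ℝ (Fin n)) (hm : Measurable m)
    (C : ℝ) (hmbd : ∀ v, ‖m v‖ ≤ C)
    (η : ℝ → ℝ) (hη : ∀ z : ℝ, η z = z * Real.log z - z)
    (γ : ℝ) (hγ : 0 < γ) (v : EuclideanSpace ℝ (Fin n))
    (α : EuclideanSpace ℝ (Fin n))
    (g : V → ℝ) (hgmeas : Measurable g) (hgnn : ∀ v', 0 ≤ g v')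
    (hηg : Integrable (fun v' => η (g v')) μ)
    (hmg : Integrable (fun v' => g v' • m v') μ) :
    ⟪α, v⟫ - (∫ v', Real.exp ⟪α, m v'⟫ ∂μ) - γ / 2 * ‖α‖ ^ 2 ≤
      (∫ v', η (g v') ∂μ) +
        1 / (2 * γ) * ‖(∫ v', g v' • m v' ∂μ) - v‖ ^ 2 := by
  have hpt : ∀ v', ⟪α, g v' • m v'⟫ ≤ η (g v') + Real.exp ⟪α, m v'⟫ := by
    intro v'
    rw [real_inner_smul_right, hη]
    rcases (hgnn v').eq_or_lt with h0 | h0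
    · rw [← h0]
      have := Real.exp_pos ⟪α, m v'⟫
      simp
      exact this.le
    · have h1 := Real.add_one_le_exp (⟪α, m v'⟫ - Real.log (g v'))
      rw [Real.exp_sub, Real.exp_log h0, le_div_iff₀ h0] at h1
      linarith
  have hexp : Integrable (fun v' => Real.exp ⟪α, m v'⟫) μ := by
    refine Integrable.of_bound (C := Real.exp (‖α‖ * C)) ?_ ?_
    · exact (Real.measurable_exp.comp (hm.const_inner)).aestronglyMeasurable
    · refine Filter.Eventually.of_forall fun v' => ?_
      rw [Real.norm_eq_abs, Real.abs_exp]
      exact Real.exp_le_exp.2 ((real_inner_le_norm _ _).trans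
        (mul_le_mul_of_nonneg_left (hmbd v') (norm_nonneg _)))
  have hint := integral_mono (hmg.const_inner α) (hηg.add hexp) hpt
  have e1 : ∫ v', ⟪α, g v' • m v'⟫ ∂μ = ⟪α, ∫ v', g v' • m v' ∂μ⟫ := integral_inner hmg α
  have e2 := integral_add hηg hexp
  simp only [Pi.add_apply] at hint
  rw [e1, e2] at hint
  set M := ∫ v', g v' • m v' ∂μ with hM
  have h2 : -(‖α‖ * ‖M - v‖) ≤ ⟪α, M - v⟫ :=
    (abs_le.1 (abs_real_inner_le_norm α (M - v))).1
  rw [inner_sub_right] at h2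
  have h3 : ‖α‖ * ‖M - v‖ ≤ γ / 2 * ‖α‖ ^ 2 + 1 / (2 * γ) * ‖M - v‖ ^ 2 := by
    have h4 : γ / 2 * ‖α‖ ^ 2 + 1 / (2 * γ) * ‖M - v‖ ^ 2 - ‖α‖ * ‖M - v‖
        = 1 / (2 * γ) * (γ * ‖α‖ - ‖M - v‖) ^ 2 := by
      field_simp
      ring
    have h5 : 0 ≤ 1 / (2 * γ) * (γ * ‖α‖ - ‖M - v‖) ^ 2 := by positivity
    linarith
  linarith
end

section
/- Fix γ > 0 and α ∈ ℝⁿ, let G_α : V → (0, ∞) be defined by G_α(v') = exp(α · m(v')), and set v := ∫_V m(v') G_α(v') dμ(v') + γ·α. Then for every measurable g : V → [0, ∞) such that η∘g and v' ↦ m(v')·g(v') are μ-integrable, ∫_V η(g) dμ + (1/(2γ))‖∫_V m g dμ − v‖² ≥ ∫_V η(G_α) dμ + (1/(2γ))‖∫_V m G_α dμ − v‖² + (1/(2γ))‖∫_V m g dμ − ∫_V m G_α dμ‖². In particular, G_α minimizes the relaxed entropy functional H_γ(·; v) over all such g. -/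
open MeasureTheory RealInnerProductSpace

/-- the Maxwell–Boltzmann ansatz `G_α = exp(α ⬝ m)` minimizes the
relaxed entropy functional `H_γ(·; v)` at `v = ∫ m G_α dμ + γ α`, with a
quantitative improvement term, for the Maxwell–Boltzmann entropy
`η(z) = z log z − z` (`η(0) = 0`; `Real.log 0 = 0` in Mathlib, so the formula
below also covers `z = 0`). -/
theorem ansatz_minimizes_relaxed_entropy
    {n : ℕ} (hn : 0 < n) {V : Type*} [MeasurableSpace V]
    (μ : Measure V) [IsFiniteMeasure μ]
    (m : V → EuclideanSpace ℝ (Fin n)) (hm : Measurable m)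
    (C : ℝ) (hmbd : ∀ v', ‖m v'‖ ≤ C)
    (η : ℝ → ℝ) (hη : ∀ z : ℝ, η z = z * Real.log z - z)
    (γ : ℝ) (hγ : 0 < γ) (α : EuclideanSpace ℝ (Fin n))
    (G : V → ℝ) (hG : ∀ v', G v' = Real.exp ⟪α, m v'⟫)
    (v : EuclideanSpace ℝ (Fin n))
    (hv : v = (∫ v', G v' • m v' ∂μ) + γ • α)
    (g : V → ℝ) (hgmeas : Measurable g) (hgnn : ∀ v', 0 ≤ g v')
    (hηg : Integrable (fun v' => η (g v')) μ)
    (hmg : Integrable (fun v' => g v' • m v') μ) :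
    (∫ v', η (G v') ∂μ) +
        1 / (2 * γ) * ‖(∫ v', G v' • m v' ∂μ) - v‖ ^ 2 +
        1 / (2 * γ) *
          ‖(∫ v', g v' • m v' ∂μ) - (∫ v', G v' • m v' ∂μ)‖ ^ 2 ≤
      (∫ v', η (g v') ∂μ) +
        1 / (2 * γ) * ‖(∫ v', g v' • m v' ∂μ) - v‖ ^ 2 := by
  have hGm : Measurable G := by
    have : G = fun v' => Real.exp ⟪α, m v'⟫ := funext hG
    rw [this]; fun_prop
  have hab : ∀ x, |⟪α, m x⟫| ≤ ‖α‖ * C := fun x =>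
    (abs_real_inner_le_norm _ _).trans
      (mul_le_mul_of_nonneg_left (hmbd x) (norm_nonneg _))
  have hGb : ∀ x, ‖G x‖ ≤ Real.exp (‖α‖ * C) := fun x => by
    rw [hG, Real.norm_eq_abs, Real.abs_exp]
    exact Real.exp_le_exp.2 ((le_abs_self _).trans (hab x))
  have hGi : Integrable G μ :=
    Integrable.of_bound hGm.aestronglyMeasurable _ (Filter.Eventually.of_forall hGb)
  have hGmi : Integrable (fun x => G x • m x) μ := by
    refine Integrable.of_bound (hGm.smul hm).aestronglyMeasurable (Real.exp (‖α‖ * C) * C)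
      (Filter.Eventually.of_forall fun x => ?_)
    rw [norm_smul]
    exact mul_le_mul (hGb x) (hmbd x) (norm_nonneg _) (Real.exp_pos _).le
  have hηG : ∀ x, η (G x) = ⟪α, G x • m x⟫ - G x := fun x => by
    rw [hη, inner_smul_right, hG, Real.log_exp]
  have i1 : Integrable (fun x => ⟪α, G x • m x⟫) μ := hGmi.const_inner α
  have i2 : Integrable (fun x => ⟪α, g x • m x⟫) μ := hmg.const_inner α
  have hpt : ∀ x, ⟪α, g x • m x⟫ - G x ≤ η (g x) := fun x => by
    rw [hη, inner_smul_right, hG]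
    rcases (hgnn x).eq_or_lt with h | h
    · rw [← h]; simp [(Real.exp_pos _).le]
    · have h1 := Real.add_one_le_exp (⟪α, m x⟫ - Real.log (g x))
      rw [Real.exp_sub, Real.exp_log h, le_div_iff₀ h] at h1
      nlinarith
  have key := integral_mono (i2.sub hGi) hηg hpt
  have e1 : ∫ x, η (G x) ∂μ = ⟪α, ∫ x, G x • m x ∂μ⟫ - ∫ x, G x ∂μ := by
    simp_rw [hηG]
    rw [integral_sub i1 hGi, integral_inner hGmi]
  have e2 : ∫ x, ((fun x => ⟪α, g x • m x⟫) - G) x ∂μ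
      = ⟪α, ∫ x, g x • m x ∂μ⟫ - ∫ x, G x ∂μ := by
    rw [integral_sub' i2 hGi, integral_inner hmg]
  rw [e2] at key
  rw [e1]
  generalize (∫ x, G x • m x ∂μ) = A at *
  generalize (∫ x, g x • m x ∂μ) = B at *
  have n1 : ‖A - v‖ ^ 2 = ‖γ • α‖ ^ 2 := by
    rw [hv, show A - (A + γ • α) = -(γ • α) by abel, norm_neg]
  have n2 : ‖B - v‖ ^ 2 = ‖B - A‖ ^ 2 - 2 * (γ * (⟪α, B⟫ - ⟪α, A⟫)) + ‖γ • α‖ ^ 2 := by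
    rw [hv, show B - (A + γ • α) = (B - A) - γ • α by abel, norm_sub_sq_real,
      inner_smul_right, real_inner_comm, inner_sub_right]
  rw [n1, n2]
  have : 1 / (2 * γ) * (‖B - A‖ ^ 2 - 2 * (γ * (⟪α, B⟫ - ⟪α, A⟫)) + ‖γ • α‖ ^ 2)
      = 1 / (2 * γ) * ‖B - A‖ ^ 2 - (⟪α, B⟫ - ⟪α, A⟫) + 1 / (2 * γ) * ‖γ • α‖ ^ 2 := by
    field_simp
  rw [this]
  linarith
end

section
/- Let v₀ > 0 and γ > 0. Define ψ : ℝ → ℝ by ψ(α) = coth(α) − 1/α + (γ/v₀)·α for α ≠ 0 and ψ(0) = 0. Then ψ is continuous, strictly increasing, and maps ℝ bijectively onto ℝ. -/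
lemma m1_sinh_lt {x : ℝ} (hx : 0 < x) : Real.sinh x < x * Real.cosh x := by
  have h : StrictMonoOn (fun y : ℝ => y * Real.cosh y - Real.sinh y) (Set.Ici 0) := by
    apply strictMonoOn_of_deriv_pos (convex_Ici 0)
    · fun_prop
    · intro y hy
      rw [interior_Ici] at hy
      have h1 : HasDerivAt (fun y : ℝ => y * Real.cosh y - Real.sinh y)
          (1 * Real.cosh y + y * Real.sinh y - Real.cosh y) y :=
        ((hasDerivAt_id y).mul (Real.hasDerivAt_cosh y)).sub (Real.hasDerivAt_sinh y)
      rw [h1.deriv]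
      have := mul_pos hy (Real.sinh_pos_iff.2 hy)
      linarith
  have := h (Set.mem_Ici.2 le_rfl) (Set.mem_Ici.2 hx.le) hx
  simp at this
  linarith

lemma m1_cosh_le {x : ℝ} (hx : 0 < x) : Real.cosh x ≤ 1 + x * Real.sinh x := by
  have h : StrictMonoOn (fun y : ℝ => y * Real.sinh y - Real.cosh y) (Set.Ici 0) := by
    apply strictMonoOn_of_deriv_pos (convex_Ici 0)
    · fun_prop
    · intro y hy
      rw [interior_Ici] at hy
      have h1 : HasDerivAt (fun y : ℝ => y * Real.sinh y - Real.cosh y)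
          (1 * Real.sinh y + y * Real.cosh y - Real.sinh y) y :=
        ((hasDerivAt_id y).mul (Real.hasDerivAt_sinh y)).sub (Real.hasDerivAt_cosh y)
      rw [h1.deriv]
      have := mul_pos hy (Real.cosh_pos y)
      linarith
  have := h (Set.mem_Ici.2 le_rfl) (Set.mem_Ici.2 hx.le) hx
  simp at this
  linarith

noncomputable def m1L (x : ℝ) : ℝ := Real.cosh x / Real.sinh x - 1 / x

lemma m1L_zero : m1L 0 = 0 := by simp [m1L]

lemma m1L_neg (x : ℝ) : m1L (-x) = - m1L x := by
  simp only [m1L, Real.cosh_neg, Real.sinh_neg, div_neg]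
  ring

lemma m1L_pos {x : ℝ} (hx : 0 < x) : 0 < m1L x := by
  have hs := Real.sinh_pos_iff.2 hx
  rw [m1L, sub_pos, div_lt_div_iff₀ hx hs]
  linarith [m1_sinh_lt hx]

lemma m1L_le {x : ℝ} (hx : 0 < x) : m1L x ≤ x := by
  have hs := Real.sinh_pos_iff.2 hx
  have h1 : Real.cosh x / Real.sinh x ≤ 1 / Real.sinh x + x := by
    rw [div_le_iff₀ hs, add_mul, one_div_mul_cancel hs.ne']
    exact m1_cosh_le hx
  have h2 : 1 / Real.sinh x ≤ 1 / x :=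
    one_div_le_one_div_of_le hx (Real.self_le_sinh_iff.2 hx.le)
  rw [m1L]
  linarith

lemma m1L_abs (x : ℝ) : |m1L x| ≤ |x| := by
  rcases lt_trichotomy x 0 with h | h | h
  · have h' : 0 < -x := by linarith
    have h1 := m1L_pos h'
    have h2 := m1L_le h'
    rw [← abs_neg, ← abs_neg x, ← m1L_neg, abs_of_pos h1, abs_of_pos h']
    exact h2
  · subst h
    simp [m1L_zero]
  · rw [abs_of_pos (m1L_pos h), abs_of_pos h]
    exact m1L_le h

lemma m1L_hasDeriv {x : ℝ} (hx : x ≠ 0) :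
    HasDerivAt m1L ((Real.sinh x * Real.sinh x - Real.cosh x * Real.cosh x) / Real.sinh x ^ 2
      - -(x ^ 2)⁻¹) x := by
  have hs : Real.sinh x ≠ 0 := fun h => hx (Real.sinh_eq_zero.1 h)
  have := ((Real.hasDerivAt_cosh x).div (Real.hasDerivAt_sinh x) hs).sub (hasDerivAt_inv hx)
  refine this.congr_of_eventuallyEq (Filter.Eventually.of_forall fun y => ?_)
  simp [m1L]

lemma m1L_cont : Continuous m1L := by
  rw [continuous_iff_continuousAt]
  intro x
  by_cases hx : x = 0
  · subst hx
    rw [ContinuousAt, m1L_zero]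
    apply squeeze_zero_norm (a := fun x : ℝ => |x|) m1L_abs
    simpa using (continuous_abs (G := ℝ)).tendsto 0
  · exact (m1L_hasDeriv hx).continuousAt

lemma m1L_mono : StrictMono m1L := by
  apply strictMono_of_odd_strictMonoOn_nonneg m1L_neg
  apply strictMonoOn_of_deriv_pos (convex_Ici 0) m1L_cont.continuousOn
  intro x hx
  rw [interior_Ici] at hx
  have hx : 0 < x := hx
  rw [(m1L_hasDeriv hx.ne').deriv]
  have h1 : Real.sinh x * Real.sinh x - Real.cosh x * Real.cosh x = -1 := by
    nlinarith [Real.cosh_sq x]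
  have h2 : 1 / Real.sinh x ^ 2 < 1 / x ^ 2 := by
    apply one_div_lt_one_div_of_lt (by positivity)
    exact pow_lt_pow_left₀ (Real.self_lt_sinh_iff.2 hx) hx.le (by norm_num)
  rw [h1, neg_div, ← one_div]
  linarith

/-- for `v₀ > 0` and `γ > 0`, the partially regularized M₁
multiplier map `ψ(α) = coth(α) − 1/α + (γ/v₀)·α` (with `ψ(0) = 0`), where
`coth x = cosh x / sinh x`, is continuous, strictly increasing, and maps `ℝ`
bijectively onto `ℝ`. -/
theorem regularized_m1_multiplier_map_bijective
    (v₀ γ : ℝ) (hv₀ : 0 < v₀) (hγ : 0 < γ)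
    (ψ : ℝ → ℝ)
    (hψ : ∀ α : ℝ, α ≠ 0 →
      ψ α = Real.cosh α / Real.sinh α - 1 / α + γ / v₀ * α)
    (hψ0 : ψ 0 = 0) :
    Continuous ψ ∧ StrictMono ψ ∧ Function.Bijective ψ := by
  have hc : 0 < γ / v₀ := div_pos hγ hv₀
  have he : ψ = fun α => m1L α + γ / v₀ * α := by
    funext α
    by_cases h : α = 0
    · subst h
      simp [hψ0, m1L_zero]
    · rw [hψ α h, m1L]
  have hcont : Continuous ψ := by
    rw [he]
    exact m1L_cont.add (by fun_prop)
  have hmono : StrictMono ψ := by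
    rw [he]
    exact m1L_mono.add (strictMono_mul_left_of_pos hc)
  refine ⟨hcont, hmono, hmono.injective, hcont.surjective ?_ ?_⟩
  · refine Filter.tendsto_atTop_mono' _ ?_ (Filter.tendsto_id.const_mul_atTop hc)
    filter_upwards [Filter.eventually_ge_atTop 0] with x hx
    have := m1L_mono.monotone hx
    rw [m1L_zero] at this
    simp only [he, id]
    linarith
  · refine Filter.tendsto_atBot_mono' _ ?_ (Filter.tendsto_id.const_mul_atBot hc)
    filter_upwards [Filter.eventually_le_atBot 0] with x hx
    have := m1L_mono.monotone hx
    rw [m1L_zero] at this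
    simp only [he, id]
    linarith
end

section
/- Let v₀ > 0, γ > 0, and v₁, v₂ ∈ ℝ, set x := v₂·v₀ − v₁² and α₂ := (x − √(x² + 2γ·v₀³)) / (2γ·v₀). Then v₂ − γ·α₂ = v₀·( v₁²/v₀² + (x + √(x² + 2γ·v₀³)) / (2·v₀²) ). In particular, the regularized second moment v̂₂ = v₂ − γ·α̂_{γ,2} is strictly positive, even when v₂ ≤ 0. -/
/-- for `v₀ > 0`, `γ > 0`, with `x = v₂v₀ − v₁²` and
`α₂ = (x − √(x² + 2γv₀³))/(2γv₀)`, the regularized second moment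
`v̂₂ = v₂ − γα₂` equals `v₀(v₁²/v₀² + (x + √(x² + 2γv₀³))/(2v₀²))` and is
strictly positive. -/
theorem regularized_euler_second_moment_positive
    (v₀ γ v₁ v₂ : ℝ) (hv₀ : 0 < v₀) (hγ : 0 < γ)
    (x : ℝ) (hx : x = v₂ * v₀ - v₁ ^ 2)
    (α₂ : ℝ) (hα₂ : α₂ = (x - Real.sqrt (x ^ 2 + 2 * γ * v₀ ^ 3)) / (2 * γ * v₀)) :
    v₂ - γ * α₂ =
      v₀ * (v₁ ^ 2 / v₀ ^ 2 +
        (x + Real.sqrt (x ^ 2 + 2 * γ * v₀ ^ 3)) / (2 * v₀ ^ 2)) ∧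
    0 < v₂ - γ * α₂ := by
  have hs : -x < Real.sqrt (x ^ 2 + 2 * γ * v₀ ^ 3) := by
    apply Real.lt_sqrt_of_sq_lt
    have : 0 < 2 * γ * v₀ ^ 3 := by positivity
    nlinarith
  generalize Real.sqrt (x ^ 2 + 2 * γ * v₀ ^ 3) = s at *
  have hv₂ : v₂ = (x + v₁ ^ 2) / v₀ := by
    rw [eq_div_iff hv₀.ne']
    linarith
  have key : v₂ - γ * α₂ =
      v₀ * (v₁ ^ 2 / v₀ ^ 2 + (x + s) / (2 * v₀ ^ 2)) := by
    clear hx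
    subst hα₂
    subst hv₂
    field_simp
    ring
  refine ⟨key, ?_⟩
  rw [key]
  have h : 0 < x + s := by linarith
  positivity
end

section
/- Let d, n be positive natural numbers, let ρ : [0, ∞) → [0, ∞) be measurable, and define the radially symmetric weight ω : ℝᵈ → [0, ∞) by ω(v) = ρ(|v|), where |·| is the Euclidean norm on ℝᵈ. Let m : ℝᵈ → ℝⁿ be measurable with each product mᵢ(v)·mⱼ(v)·ω(v) Lebesgue-integrable, and suppose the basis functions are orthonormal with respect to ω: ∫_{ℝᵈ} m(v) m(v)ᵀ ω(v) dv = I (the n×n identity matrix). Let O be a d×d orthogonal matrix and T an n×n matrix such that m(O·v) = T·m(v) for all v ∈ ℝᵈ. Then T is orthogonal: T·Tᵀ = I. -/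
open MeasureTheory

/-- if the basis functions `m : ℝᵈ → ℝⁿ` are orthonormal with
respect to a radially symmetric weight `ω(v) = ρ(|v|)`, `O` is an orthogonal
`d×d` matrix, and `T` is an `n×n` matrix with `m(O·v) = T·m(v)` for all `v`,
then `T` is orthogonal. -/
theorem rotation_matrix_orthogonal
    {d n : ℕ} (hd : 0 < d) (hn : 0 < n)
    (ρ : ℝ → ℝ) (hρmeas : Measurable ρ) (hρnn : ∀ r : ℝ, 0 ≤ r → 0 ≤ ρ r)
    (ω : EuclideanSpace ℝ (Fin d) → ℝ) (hω : ∀ v, ω v = ρ ‖v‖)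
    (m : EuclideanSpace ℝ (Fin d) → EuclideanSpace ℝ (Fin n))
    (hmmeas : Measurable m)
    (hint : ∀ i j : Fin n, Integrable (fun v => m v i * m v j * ω v))
    (horth : ∀ i j : Fin n,
      (∫ v, m v i * m v j * ω v) = if i = j then (1 : ℝ) else 0)
    (O : Matrix (Fin d) (Fin d) ℝ) (hO : O * O.transpose = 1)
    (T : Matrix (Fin n) (Fin n) ℝ)
    (hT : ∀ v, m (Matrix.toEuclideanLin O v) = Matrix.toEuclideanLin T (m v)) :
    T * T.transpose = 1 := by
  have hO2 : O.transpose * O = 1 := mul_eq_one_comm.mp hO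
  have hnorm : ∀ v, ‖Matrix.toEuclideanLin O v‖ = ‖v‖ := by
    intro v
    have h : ∀ w : EuclideanSpace ℝ (Fin d), ‖w‖ ^ 2 = w.ofLp ⬝ᵥ w.ofLp := by
      intro w
      rw [EuclideanSpace.real_norm_sq_eq]
      simp [dotProduct, sq]
    have h2 : ‖Matrix.toEuclideanLin O v‖ ^ 2 = ‖v‖ ^ 2 := by
      rw [h, h]
      have : (Matrix.toEuclideanLin O v).ofLp = O.mulVec v.ofLp := rfl
      rw [this, Matrix.dotProduct_mulVec, Matrix.vecMul_mulVec, hO2, Matrix.vecMul_one]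
    exact (sq_eq_sq₀ (norm_nonneg _) (norm_nonneg _)).mp h2
  let L : EuclideanSpace ℝ (Fin d) →ₗᵢ[ℝ] EuclideanSpace ℝ (Fin d) :=
    ⟨Matrix.toEuclideanLin O, hnorm⟩
  let e := L.toLinearIsometryEquiv rfl
  have he : ∀ v, e v = Matrix.toEuclideanLin O v := fun v => rfl
  have hTc : ∀ v i, m (e v) i = ∑ k, T i k * m v k := by
    intro v i
    rw [he, hT]
    rfl
  have hωe : ∀ v, ω (e v) = ω v := by
    intro v
    rw [hω, hω, e.norm_map]
  ext i j
  rw [Matrix.one_apply, ← horth i j]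
  have hcv := e.measurePreserving.integral_comp e.toHomeomorph.measurableEmbedding
    (fun v => m v i * m v j * ω v)
  rw [← hcv]
  have hexp : ∀ v, m (e v) i * m (e v) j * ω (e v)
      = ∑ k, ∑ l, T i k * T j l * (m v k * m v l * ω v) := by
    intro v
    rw [hTc, hTc, hωe, Finset.sum_mul_sum, Finset.sum_mul]
    refine Finset.sum_congr rfl fun k _ => ?_
    rw [Finset.sum_mul]
    refine Finset.sum_congr rfl fun l _ => ?_
    ring
  simp only [hexp]
  rw [integral_finsetSum _ (fun k _ => integrable_finsetSum _
    (fun l _ => (hint k l).const_mul _))]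
  rw [Matrix.mul_apply]
  refine Finset.sum_congr rfl fun k _ => ?_
  rw [integral_finsetSum _ (fun l _ => (hint k l).const_mul _)]
  simp only [integral_const_mul, horth]
  simp
end

section
/- Let D ⊆ ℝ be an interval and η : ℝ → ℝ be differentiable and convex on D. Let g : [−1, 1] → D be Lebesgue-integrable with η∘g integrable, let ḡ := (1/2)·∫_{−1}^{1} g(μ) dμ, assume ḡ ∈ D, and assume μ ↦ η'(g(μ))·(ḡ − g(μ)) is integrable. Then ∫_{−1}^{1} η'(g(μ))·(ḡ − g(μ)) dμ ≤ 0. (This is the entropy-dissipation inequality ⟨η'(g)·𝒞(g)⟩ ≤ 0 for the isotropic-scattering collision operator 𝒞(g) = σ_s·(ḡ − g) with σ_s ≥ 0.) -/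
open MeasureTheory

/-- entropy dissipation of the isotropic-scattering collision
operator: for a convex differentiable entropy `η` on an interval `D` and an
integrable `g : [−1,1] → D` with angular average `ḡ = (1/2)∫ g ∈ D`,
`∫_{−1}^{1} η'(g(μ))(ḡ − g(μ)) dμ ≤ 0`. -/
theorem isotropic_scattering_entropy_dissipation
    (D : Set ℝ) (hD : Convex ℝ D)
    (η : ℝ → ℝ)
    (hdiff : ∀ x ∈ D, DifferentiableAt ℝ η x)
    (hconv : ConvexOn ℝ D η)
    (g : ℝ → ℝ) (hgD : ∀ x ∈ Set.Icc (-1 : ℝ) 1, g x ∈ D)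
    (hgint : IntegrableOn g (Set.Icc (-1 : ℝ) 1))
    (hηgint : IntegrableOn (fun x => η (g x)) (Set.Icc (-1 : ℝ) 1))
    (gbar : ℝ) (hgbar : gbar = (1 / 2) * ∫ x in (-1 : ℝ)..1, g x)
    (hgbarD : gbar ∈ D)
    (hint : IntegrableOn (fun x => deriv η (g x) * (gbar - g x))
      (Set.Icc (-1 : ℝ) 1)) :
    (∫ x in (-1 : ℝ)..1, deriv η (g x) * (gbar - g x)) ≤ 0 := by
  have hmono : MonotoneOn (deriv η) D := hconv.monotoneOn_deriv hdiff
  have hle : (-1 : ℝ) ≤ 1 := by norm_num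
  have hg' : IntervalIntegrable g volume (-1) 1 :=
    (intervalIntegrable_iff_integrableOn_Icc_of_le hle).2 hgint
  have hi' : IntervalIntegrable (fun x => deriv η (g x) * (gbar - g x)) volume (-1) 1 :=
    (intervalIntegrable_iff_integrableOn_Icc_of_le hle).2 hint
  have hc : IntervalIntegrable (fun _ : ℝ => gbar) volume (-1) 1 :=
    intervalIntegrable_const
  have hr : IntervalIntegrable (fun x => deriv η gbar * (gbar - g x)) volume (-1) 1 :=
    (hc.sub hg').const_mul _
  have key := intervalIntegral.integral_mono_on hle hi' hr (by
    intro x hx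
    have hx' := hgD x hx
    rcases le_total (g x) gbar with h | h
    · have := hmono hx' hgbarD h
      nlinarith
    · have := hmono hgbarD hx' h
      nlinarith)
  have hz : (∫ x in (-1 : ℝ)..1, deriv η gbar * (gbar - g x)) = 0 := by
    rw [intervalIntegral.integral_const_mul, intervalIntegral.integral_sub hc hg',
      intervalIntegral.integral_const, smul_eq_mul]
    have : (1 - (-1 : ℝ)) * gbar - ∫ x in (-1 : ℝ)..1, g x = 0 := by
      rw [hgbar]; ring
    rw [this, mul_zero]
  exact key.trans hz.le
end
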